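/- A finite-dimensional Poisson algebra P is nilpotent if and only if φ(P) = P^2, where P^2 = P·P + [P,P]. Moreover, if P is nilpotent then every maximal subalgebra of P is a Poisson ideal. Conversely, if every maximal subalgebra of P is an ideal, then either P is nilpotent or P = Fe ⊕ N where e is an idempotent (e·e = e, [e,P] = 0 follows) and N is the nilradical of P. -/

import Mathlib

/-!  Framework: dialgebras and Poisson algebras as bilinear structures on a module. -/

variable {F P : Type*} [Field F] [AddCommGroup P] [Module F P]

/-- A dialgebra: a vector space with two bilinear multiplications. -/
structure Dialgebra (F P : Type*) [Field F] [AddCommGroup P] [Module F P] where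
  mul : P →ₗ[F] P →ₗ[F] P
  bracket : P →ₗ[F] P →ₗ[F] P

namespace Dialgebra

variable (D : Dialgebra F P)

/-- Span of the set of products `a·b`, `a ∈ A`, `b ∈ B`. -/
def pmul (A B : Submodule F P) : Submodule F P :=
  Submodule.span F (Set.image2 (fun a b => D.mul a b) (A : Set P) (B : Set P))

/-- Span of the set of brackets `[a,b]`, `a ∈ A`, `b ∈ B`. -/
def pbra (A B : Submodule F P) : Submodule F P :=
  Submodule.span F (Set.image2 (fun a b => D.bracket a b) (A : Set P) (B : Set P))

/-- `A·B + [A,B]`. -/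
def psq (A B : Submodule F P) : Submodule F P := D.pmul A B ⊔ D.pbra A B

/-- A subalgebra: a subspace closed under both products. -/
def IsSubalgebra (A : Submodule F P) : Prop := D.psq A A ≤ A

/-- An ideal of the dialgebra. -/
def IsIdeal (A : Submodule F P) : Prop :=
  D.pmul A ⊤ ≤ A ∧ D.pmul ⊤ A ≤ A ∧ D.pbra A ⊤ ≤ A ∧ D.pbra ⊤ A ≤ A

/-- `A` is an ideal of the subalgebra `U`. -/
def IsIdealIn (A U : Submodule F P) : Prop :=
  A ≤ U ∧ D.pmul A U ≤ A ∧ D.pmul U A ≤ A ∧ D.pbra A U ≤ A ∧ D.pbra U A ≤ A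

/-- Lower central series of `B`: `B^1 = B`, `B^{n+1} = B^n·B + [B^n,B]`. -/
def lcs (B : Submodule F P) : ℕ → Submodule F P
  | 0 => B
  | n + 1 => D.psq (lcs B n) B

/-- `B` is nilpotent as a dialgebra. -/
def IsNilpotentSub (B : Submodule F P) : Prop := ∃ n, D.lcs B n = ⊥

/-- Derived series of `B`. -/
def ders (B : Submodule F P) : ℕ → Submodule F P
  | 0 => B
  | n + 1 => D.psq (ders B n) (ders B n)

/-- `B` is solvable as a dialgebra. -/
def IsSolvableSub (B : Submodule F P) : Prop := ∃ n, D.ders B n = ⊥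

/-- Associative powers: `apow B n = B_A^{n+1}`, i.e. `apow B 0 = B_A^1 = B`. -/
def apow (B : Submodule F P) : ℕ → Submodule F P
  | 0 => B
  | n + 1 => D.pmul (apow B n) B

/-- Lie powers: `lpow B n = B_L^{n+1}`. -/
def lpow (B : Submodule F P) : ℕ → Submodule F P
  | 0 => B
  | n + 1 => D.pbra (lpow B n) B

/-- Associative nilpotency of `B`. -/
def AssocNilpotent (B : Submodule F P) : Prop := ∃ n, D.apow B n = ⊥

/-- Lie nilpotency of `B`. -/
def LieNilpotent (B : Submodule F P) : Prop := ∃ n, D.lpow B n = ⊥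

/-- `mulPows B X n = X·B_A^n` (with the convention that it is `X` for `n = 0`). -/
def mulPows (B X : Submodule F P) : ℕ → Submodule F P
  | 0 => X
  | n + 1 => D.pmul (mulPows B X n) B

/-- `M` is a maximal (proper) subalgebra of the subalgebra `U`. -/
def IsMaximalSubalgebraIn (U M : Submodule F P) : Prop :=
  D.IsSubalgebra M ∧ M < U ∧ ∀ K, D.IsSubalgebra K → M ≤ K → K ≤ U → K = M ∨ K = U

/-- Frattini subalgebra of the subalgebra `U`: intersection of its maximal subalgebras. -/
def frattiniIn (U : Submodule F P) : Submodule F P :=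
  U ⊓ sInf {M | D.IsMaximalSubalgebraIn U M}

/-- Frattini ideal of the subalgebra `U`: largest ideal of `U` inside `frattiniIn U`. -/
def phiIn (U : Submodule F P) : Submodule F P :=
  sSup {I | D.IsIdealIn I U ∧ I ≤ D.frattiniIn U}

/-- Frattini subalgebra of the dialgebra. -/
def frattini : Submodule F P := D.frattiniIn ⊤

/-- Frattini ideal of the dialgebra. -/
def phi : Submodule F P := sSup {I | D.IsIdeal I ∧ I ≤ D.frattini}

/-- Minimal ideal. -/
def IsMinimalIdeal (A : Submodule F P) : Prop :=
  D.IsIdeal A ∧ A ≠ ⊥ ∧ ∀ I, D.IsIdeal I → I ≤ A → I = ⊥ ∨ I = A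

/-- Zero (trivial-multiplication) subspace. -/
def IsZeroAlg (A : Submodule F P) : Prop := D.pmul A A = ⊥ ∧ D.pbra A A = ⊥

/-- Zero socle: sum of the minimal zero ideals. -/
def zsoc : Submodule F P := sSup {A | D.IsMinimalIdeal A ∧ D.IsZeroAlg A}

/-- Socle: sum of the minimal ideals. -/
def soc : Submodule F P := sSup {A | D.IsMinimalIdeal A}

/-- Annihilator of `B` in the algebra. -/
def annih (B : Submodule F P) : Submodule F P where
  carrier := {x | ∀ b ∈ B, D.mul x b = 0 ∧ D.bracket x b = 0}
  add_mem' := by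
    intro x y hx hy b hb
    have h1 := hx b hb; have h2 := hy b hb
    constructor <;> simp [map_add, LinearMap.add_apply, h1.1, h1.2, h2.1, h2.2]
  zero_mem' := by intro b hb; simp
  smul_mem' := by
    intro c x hx b hb
    have h := hx b hb
    constructor <;> simp [map_smul, LinearMap.smul_apply, h.1, h.2]

/-- `R` is the solvable radical: the largest solvable ideal. -/
def IsRadical (R : Submodule F P) : Prop :=
  D.IsIdeal R ∧ D.IsSolvableSub R ∧ ∀ I, D.IsIdeal I → D.IsSolvableSub I → I ≤ R

/-- `N` is the nilradical: the largest nilpotent ideal. -/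
def IsNilradical (N : Submodule F P) : Prop :=
  D.IsIdeal N ∧ D.IsNilpotentSub N ∧ ∀ I, D.IsIdeal I → D.IsNilpotentSub I → I ≤ N

end Dialgebra

/-- A Poisson algebra: commutative associative product and Lie bracket linked by the Leibniz rule. -/
structure PoissonAlgebra (F P : Type*) [Field F] [AddCommGroup P] [Module F P]
    extends Dialgebra F P where
  mul_comm : ∀ x y, mul x y = mul y x
  mul_assoc : ∀ x y z, mul (mul x y) z = mul x (mul y z)
  lie_self : ∀ x, bracket x x = 0
  leibniz_lie : ∀ x y z, bracket x (bracket y z) = bracket (bracket x y) z + bracket y (bracket x z)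
  leibniz : ∀ x y z, bracket (mul x y) z = mul (bracket x z) y + mul x (bracket y z)

attribute [local instance] LieRing.ofAssociativeRing

/-- Engel's theorem, phrased for descending chains of subspaces. -/
theorem exists_eq_bot_of_isNilpotent [FiniteDimensional F P]
    (G : LieSubalgebra F (Module.End F P)) (hG : ∀ g ∈ G, IsNilpotent g)
    (V : ℕ → Submodule F P)
    (hV : ∀ n (W : Submodule F P), (∀ g ∈ G, ∀ v ∈ V n, g v ∈ W) → V (n + 1) ≤ W) :
    ∃ n, V n = ⊥ := by
  have hnil : LieModule.IsNilpotent G P := by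
    rw [LieModule.isNilpotent_iff_forall' (R := F)]
    rintro ⟨g, hg⟩
    exact hG g hg
  obtain ⟨k, hk⟩ := (LieModule.isNilpotent_iff F G P).1 hnil
  have hle : ∀ n, V n ≤ (LieModule.lowerCentralSeries F G P n).toSubmodule := by
    intro n
    induction n with
    | zero => simp
    | succ n ih =>
      refine hV n _ fun g hg v hv => ?_
      rw [LieModule.lowerCentralSeries_succ]
      exact LieSubmodule.lie_mem_lie (x := (⟨g, hg⟩ : G)) (LieSubmodule.mem_top _) (ih hv)
  exact ⟨k, by simpa [hk] using hle k⟩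

/-- Fitting's lemma with a positive exponent. -/
theorem exists_isCompl_ker_range_pow [FiniteDimensional F P] (f : Module.End F P) :
    ∃ n, IsCompl (LinearMap.ker (f ^ (n + 1))) (LinearMap.range (f ^ (n + 1))) := by
  obtain ⟨n, hn⟩ := Filter.eventually_atTop.1 f.eventually_isCompl_ker_pow_range_pow
  exact ⟨n, hn _ n.le_succ⟩

/-- A derivation of a bilinear product acts on products of vectors it kills to powers `n`, `k`. -/
theorem pow_add_apply_eq_zero_of_derivation (d : Module.End F P) (m : P →ₗ[F] P →ₗ[F] P)
    (hd : ∀ y z, d (m y z) = m (d y) z + m y (d z)) :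
    ∀ (n k : ℕ) (y z : P), (d ^ n) y = 0 → (d ^ k) z = 0 → (d ^ (n + k)) (m y z) = 0 := by
  intro n
  induction n with
  | zero => intro k y z hy _; simp_all
  | succ n ihn =>
    intro k
    induction k with
    | zero => intro y z _ hz; simp_all
    | succ k ihk =>
      intro y z hy hz
      have h1 := ihn (k + 1) (d y) z (by simpa [pow_succ] using hy) hz
      have h2 := ihk y (d z) hy (by simpa [pow_succ] using hz)
      rw [show n + 1 + (k + 1) = (n + 1 + k) + 1 by omega, pow_succ, Module.End.mul_apply, hd,
        map_add, h2, show n + 1 + k = n + (k + 1) by omega, h1, add_zero]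

namespace Dialgebra

variable (D : Dialgebra F P)

theorem pmul_le {A B C : Submodule F P} :
    D.pmul A B ≤ C ↔ ∀ a ∈ A, ∀ b ∈ B, D.mul a b ∈ C := by
  simp [pmul, Submodule.span_le, Set.subset_def, Set.mem_image2]
  aesop

theorem pbra_le {A B C : Submodule F P} :
    D.pbra A B ≤ C ↔ ∀ a ∈ A, ∀ b ∈ B, D.bracket a b ∈ C := by
  simp [pbra, Submodule.span_le, Set.subset_def, Set.mem_image2]
  aesop

theorem psq_le {A B C : Submodule F P} :
    D.psq A B ≤ C ↔ ∀ a ∈ A, ∀ b ∈ B, D.mul a b ∈ C ∧ D.bracket a b ∈ C := by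
  rw [psq, sup_le_iff, pmul_le, pbra_le]
  exact ⟨fun h a ha b hb => ⟨h.1 a ha b hb, h.2 a ha b hb⟩,
    fun h => ⟨fun a ha b hb => (h a ha b hb).1, fun a ha b hb => (h a ha b hb).2⟩⟩

variable {D} {A B : Submodule F P} {a b : P}

theorem mul_mem_pmul (ha : a ∈ A) (hb : b ∈ B) : D.mul a b ∈ D.pmul A B :=
  D.pmul_le.1 le_rfl a ha b hb

theorem bracket_mem_pbra (ha : a ∈ A) (hb : b ∈ B) : D.bracket a b ∈ D.pbra A B :=
  D.pbra_le.1 le_rfl a ha b hb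

theorem mul_mem_psq (ha : a ∈ A) (hb : b ∈ B) : D.mul a b ∈ D.psq A B :=
  (D.psq_le.1 le_rfl a ha b hb).1

theorem bracket_mem_psq (ha : a ∈ A) (hb : b ∈ B) : D.bracket a b ∈ D.psq A B :=
  (D.psq_le.1 le_rfl a ha b hb).2

theorem IsSubalgebra.apow_antitone (hB : D.IsSubalgebra B) : Antitone (D.apow B) := by
  refine antitone_nat_of_succ_le fun n => ?_
  induction n with
  | zero => exact le_sup_left.trans hB
  | succ n ih => exact D.pmul_le.2 fun a ha b hb => mul_mem_pmul (ih ha) hb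

theorem lcs_top_antitone : Antitone (D.lcs ⊤) := by
  refine antitone_nat_of_succ_le fun n => ?_
  induction n with
  | zero => exact le_top
  | succ n ih =>
    exact D.psq_le.2 fun a ha b hb => ⟨mul_mem_psq (ih ha) hb, bracket_mem_psq (ih ha) hb⟩

theorem lpow_mono (h : A ≤ B) (n : ℕ) : D.lpow A n ≤ D.lpow B n := by
  induction n with
  | zero => exact h
  | succ n ih => exact D.pbra_le.2 fun a ha b hb => bracket_mem_pbra (ih ha) (h hb)

theorem IsSubalgebra.exists_le_maximal [FiniteDimensional F P] (hA : D.IsSubalgebra A)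
    (hne : A ≠ ⊤) : ∃ M, D.IsMaximalSubalgebraIn ⊤ M ∧ A ≤ M := by
  obtain ⟨M, ⟨hM, hAM, hMt⟩, hmax⟩ := (wellFounded_gt (α := Submodule F P)).has_min
    {K | D.IsSubalgebra K ∧ A ≤ K ∧ K ≠ ⊤} ⟨A, hA, le_rfl, hne⟩
  refine ⟨M, ⟨hM, lt_top_iff_ne_top.2 hMt, fun K hK hMK _ => ?_⟩, hAM⟩
  by_contra! hcon
  exact hmax K ⟨hK, hAM.trans hMK, hcon.2⟩ (lt_of_le_of_ne hMK (Ne.symm hcon.1))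

theorem isSubalgebra_of_psq_top_le (h : D.psq ⊤ ⊤ ≤ A) : D.IsSubalgebra A :=
  D.psq_le.2 fun _ _ _ _ =>
    ⟨h (mul_mem_psq Submodule.mem_top Submodule.mem_top),
      h (bracket_mem_psq Submodule.mem_top Submodule.mem_top)⟩

theorem isIdeal_of_psq_top_le (h : D.psq ⊤ ⊤ ≤ A) : D.IsIdeal A :=
  have hm (a b : P) : D.mul a b ∈ A := h (mul_mem_psq Submodule.mem_top Submodule.mem_top)
  have hb (a b : P) : D.bracket a b ∈ A := h (bracket_mem_psq Submodule.mem_top Submodule.mem_top)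
  ⟨D.pmul_le.2 fun a _ b _ => hm a b, D.pmul_le.2 fun a _ b _ => hm a b,
    D.pbra_le.2 fun a _ b _ => hb a b, D.pbra_le.2 fun a _ b _ => hb a b⟩

theorem IsIdeal.mul_mem (hA : D.IsIdeal A) (ha : a ∈ A) (b : P) : D.mul a b ∈ A :=
  hA.1 (mul_mem_pmul ha Submodule.mem_top)

theorem IsIdeal.bracket_mem (hA : D.IsIdeal A) (ha : a ∈ A) (b : P) : D.bracket a b ∈ A :=
  hA.2.2.1 (bracket_mem_pbra ha Submodule.mem_top)

variable (D) in
theorem frattini_le_psq_top : D.frattini ≤ D.psq ⊤ ⊤ := by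
  intro v hv
  by_contra hnot
  obtain ⟨f, hfv, hle⟩ := Submodule.exists_le_ker_of_notMem hnot
  have hco : IsCoatom (LinearMap.ker f) :=
    LinearMap.isCoatom_ker_of_surjective (LinearMap.surjective (by rintro rfl; simp at hfv))
  have hmax : D.IsMaximalSubalgebraIn ⊤ (LinearMap.ker f) :=
    ⟨isSubalgebra_of_psq_top_le hle, hco.lt_top,
      fun K _ hK _ => hK.eq_or_lt.imp Eq.symm (hco.2 K)⟩
  exact hfv (Submodule.mem_sInf.1 hv.2 _ hmax)

variable (D) in
theorem phi_le_frattini : D.phi ≤ D.frattini := sSup_le fun _ h => h.2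

variable (D) in
theorem phi_eq_psq_top_iff :
    D.phi = D.psq ⊤ ⊤ ↔ ∀ M, D.IsMaximalSubalgebraIn ⊤ M → D.psq ⊤ ⊤ ≤ M := by
  constructor
  · intro h M hM
    exact h ▸ D.phi_le_frattini.trans (inf_le_right.trans (sInf_le hM))
  · intro h
    refine le_antisymm (D.phi_le_frattini.trans D.frattini_le_psq_top) (le_sSup ⟨?_, ?_⟩)
    · exact isIdeal_of_psq_top_le le_rfl
    · exact le_inf le_top (le_sInf h)

end Dialgebra

namespace PoissonAlgebra

open Dialgebra

variable (Q : PoissonAlgebra F P) {A B : Submodule F P}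

theorem bracket_skew (x y : P) : Q.bracket x y = -Q.bracket y x := by
  have h := Q.lie_self (x + y)
  simp only [map_add, LinearMap.add_apply, Q.lie_self, zero_add, add_zero] at h
  exact eq_neg_of_add_eq_zero_right h

theorem bracket_mul (x y z : P) :
    Q.bracket x (Q.mul y z) = Q.mul (Q.bracket x y) z + Q.mul y (Q.bracket x z) := by
  rw [Q.bracket_skew, Q.leibniz, Q.bracket_skew y x, Q.bracket_skew z x]
  simp [add_comm]

theorem isIdeal_of_forall (h : ∀ a ∈ A, ∀ b, Q.mul a b ∈ A ∧ Q.bracket a b ∈ A) :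
    Q.toDialgebra.IsIdeal A :=
  ⟨Q.pmul_le.2 fun a ha b _ => (h a ha b).1,
    Q.pmul_le.2 fun a _ b hb => Q.mul_comm b a ▸ (h b hb a).1,
    Q.pbra_le.2 fun a ha b _ => (h a ha b).2,
    Q.pbra_le.2 fun a _ b hb => Q.bracket_skew a b ▸ A.neg_mem (h b hb a).2⟩

theorem bracket_mem_apow (hB : Q.toDialgebra.IsSubalgebra B) (n : ℕ) :
    ∀ a ∈ Q.toDialgebra.apow B n, ∀ b ∈ B, Q.bracket a b ∈ Q.toDialgebra.apow B n := by
  induction n with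
  | zero => exact fun a ha b hb => (Q.psq_le.1 hB a ha b hb).2
  | succ n ih =>
    intro a ha b hb
    suffices h : Q.toDialgebra.apow B (n + 1) ≤
        (Q.toDialgebra.apow B (n + 1)).comap (Q.bracket.flip b) from h ha
    refine Q.pmul_le.2 fun x hx y hy => ?_
    rw [Submodule.mem_comap, LinearMap.flip_apply, Q.leibniz]
    exact add_mem (mul_mem_pmul (ih x hx b hb) hy)
      (mul_mem_pmul hx (Q.psq_le.1 hB y hy b hb).2)

/-- Associative and Lie nilpotency together give nilpotency. -/
theorem isNilpotentSub_of_assoc_lie (hB : Q.toDialgebra.IsSubalgebra B)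
    (ha : Q.toDialgebra.AssocNilpotent B) (hl : Q.toDialgebra.LieNilpotent B) :
    Q.toDialgebra.IsNilpotentSub B := by
  obtain ⟨r, hr⟩ := ha
  obtain ⟨c, hc⟩ := hl
  suffices h : ∀ k, ∃ m, Q.toDialgebra.lcs B m ≤ Q.toDialgebra.apow B k by
    obtain ⟨m, hm⟩ := h r
    exact ⟨m, by simpa [hr] using hm⟩
  intro k
  induction k with
  | zero => exact ⟨0, le_rfl⟩
  | succ k ih =>
    obtain ⟨m, hm⟩ := ih
    have hanti := hB.apow_antitone
    have key : ∀ j, Q.toDialgebra.lcs B (m + j) ≤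
        Q.toDialgebra.apow B (k + 1) ⊔ (Q.toDialgebra.apow B k ⊓ Q.toDialgebra.lpow B j) := by
      intro j
      induction j with
      | zero => exact le_sup_of_le_right (le_inf hm (hm.trans (hanti k.zero_le)))
      | succ j ihj =>
        refine Q.psq_le.2 fun z hz b hb => ?_
        obtain ⟨u, hu, v, hv, rfl⟩ := Submodule.mem_sup.1 (ihj hz)
        simp only [map_add, LinearMap.add_apply]
        constructor
        · exact Submodule.mem_sup_left (add_mem
            (hanti (k + 1).le_succ (mul_mem_pmul hu hb)) (mul_mem_pmul hv.1 hb))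
        · exact add_mem (Submodule.mem_sup_left (Q.bracket_mem_apow hB _ u hu b hb))
            (Submodule.mem_sup_right
              ⟨Q.bracket_mem_apow hB _ v hv.1 b hb, bracket_mem_pbra hv.2 hb⟩)
    exact ⟨m + c, (key c).trans (by simp [hc])⟩

theorem assocNilpotent_of_forall [FiniteDimensional F P]
    (h : ∀ x ∈ B, IsNilpotent (Q.mul x : Module.End F P)) : Q.toDialgebra.AssocNilpotent B := by
  let G : LieSubalgebra F (Module.End F P) :=
    { B.map Q.mul with
      lie_mem' := by
        rintro _ _ ⟨x, hx, rfl⟩ ⟨y, hy, rfl⟩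
        have h0 : ⁅(Q.mul x : Module.End F P), (Q.mul y : Module.End F P)⁆ = 0 := by
          ext z
          simp [LieRing.of_associative_ring_bracket, ← Q.mul_assoc, Q.mul_comm y x]
        rw [h0]
        exact zero_mem (B.map Q.mul) }
  refine exists_eq_bot_of_isNilpotent G ?_ _ fun n W hW => Q.pmul_le.2 fun a ha b hb => ?_
  · rintro _ ⟨x, hx, rfl⟩
    exact h x hx
  · rw [Q.mul_comm]
    exact hW _ ⟨b, hb, rfl⟩ a ha

theorem lieNilpotent_top_of_forall [FiniteDimensional F P]
    (h : ∀ x, IsNilpotent (Q.bracket x : Module.End F P)) : Q.toDialgebra.LieNilpotent ⊤ := by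
  let G : LieSubalgebra F (Module.End F P) :=
    { LinearMap.range Q.bracket with
      lie_mem' := by
        rintro _ _ ⟨x, rfl⟩ ⟨y, rfl⟩
        refine ⟨Q.bracket x y, ?_⟩
        ext z
        simp [LieRing.of_associative_ring_bracket, Q.leibniz_lie x y z] }
  refine exists_eq_bot_of_isNilpotent G ?_ _ fun n W hW => Q.pbra_le.2 fun a ha b _ => ?_
  · rintro _ ⟨x, rfl⟩
    exact h x
  · rw [Q.bracket_skew]
    exact W.neg_mem (hW _ ⟨b, rfl⟩ a ha)

theorem psq_top_le_of_isMaximalSubalgebraIn (hnil : Q.toDialgebra.IsNilpotentSub ⊤)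
    {M : Submodule F P} (hM : Q.toDialgebra.IsMaximalSubalgebraIn ⊤ M) :
    Q.toDialgebra.psq ⊤ ⊤ ≤ M := by
  have step : ∀ n, Q.toDialgebra.lcs ⊤ (n + 1) ≤ M → Q.toDialgebra.psq ⊤ ⊤ ≤ M := by
    intro n
    induction n with
    | zero => exact id
    | succ n ih =>
      intro hn
      by_cases hle : Q.toDialgebra.lcs ⊤ (n + 1) ≤ M
      · exact ih hle
      have hmem : ∀ a ∈ M ⊔ Q.toDialgebra.lcs ⊤ (n + 1), ∀ b ∈ M ⊔ Q.toDialgebra.lcs ⊤ (n + 1),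
          Q.mul a b ∈ M ∧ Q.bracket a b ∈ M := by
        intro a ha b hb
        obtain ⟨u, hu, v, hv, rfl⟩ := Submodule.mem_sup.1 ha
        obtain ⟨s, hs, t, ht, rfl⟩ := Submodule.mem_sup.1 hb
        have hus := Q.psq_le.1 hM.1 u hu s hs
        have hr : ∀ v ∈ Q.toDialgebra.lcs ⊤ (n + 1), ∀ y, Q.mul v y ∈ M ∧ Q.bracket v y ∈ M :=
          fun v hv y => ⟨hn (mul_mem_psq hv Submodule.mem_top),
            hn (bracket_mem_psq hv Submodule.mem_top)⟩
        have hl : Q.mul u t ∈ M ∧ Q.bracket u t ∈ M := by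
          rw [Q.mul_comm, Q.bracket_skew]
          exact ⟨(hr t ht u).1, M.neg_mem (hr t ht u).2⟩
        simp only [map_add, LinearMap.add_apply]
        have h1 := hr v hv s
        have h2 := hr v hv t
        exact ⟨add_mem (add_mem hus.1 h1.1) (add_mem hl.1 h2.1),
          add_mem (add_mem hus.2 h1.2) (add_mem hl.2 h2.2)⟩
      have hsub : Q.toDialgebra.IsSubalgebra (M ⊔ Q.toDialgebra.lcs ⊤ (n + 1)) :=
        Q.psq_le.2 fun a ha b hb =>
          ⟨Submodule.mem_sup_left (hmem a ha b hb).1, Submodule.mem_sup_left (hmem a ha b hb).2⟩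
      rcases hM.2.2 _ hsub le_sup_left le_top with h | h
      · exact absurd (sup_eq_left.1 h) hle
      · rw [h] at hmem
        exact Q.psq_le.2 hmem
  obtain ⟨n, hn⟩ := hnil
  exact step n ((lcs_top_antitone n.le_succ).trans (hn ▸ bot_le))

theorem isNilpotent_bracket_of_maximal_isIdeal [FiniteDimensional F P]
    (hmax : ∀ M, Q.toDialgebra.IsMaximalSubalgebraIn ⊤ M → Q.toDialgebra.IsIdeal M) (x : P) :
    IsNilpotent (Q.bracket x : Module.End F P) := by
  set f : Module.End F P := Q.bracket x with hf
  obtain ⟨n, hn⟩ := exists_isCompl_ker_range_pow f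
  have hker : ∀ y, (f ^ (n + 1 + (n + 1))) y = 0 → y ∈ LinearMap.ker (f ^ (n + 1)) := by
    intro y hy
    have hy' : (f ^ (n + 1)) y ∈ LinearMap.ker (f ^ (n + 1)) ⊓ LinearMap.range (f ^ (n + 1)) :=
      ⟨by simpa [pow_add] using hy, y, rfl⟩
    rw [hn.inf_eq_bot] at hy'
    exact hy'
  have hsub : Q.toDialgebra.IsSubalgebra (LinearMap.ker (f ^ (n + 1))) :=
    Q.psq_le.2 fun a ha b hb =>
      ⟨hker _ (pow_add_apply_eq_zero_of_derivation f Q.mul (Q.bracket_mul x) _ _ a b ha hb),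
        hker _ (pow_add_apply_eq_zero_of_derivation f Q.bracket (Q.leibniz_lie x) _ _ a b ha hb)⟩
  by_cases htop : LinearMap.ker (f ^ (n + 1)) = ⊤
  · exact ⟨n + 1, LinearMap.ker_eq_top.1 htop⟩
  obtain ⟨M, hM, hle⟩ := hsub.exists_le_maximal htop
  have hx : x ∈ M := hle (by simp [pow_succ, hf, Q.lie_self])
  have hrange : LinearMap.range (f ^ (n + 1)) ≤ M := by
    rintro _ ⟨y, rfl⟩
    rw [pow_succ', Module.End.mul_apply]
    exact (hmax M hM).bracket_mem hx _
  exact absurd (top_le_iff.1 (hn.sup_eq_top ▸ sup_le hle hrange)) hM.2.1.ne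

theorem exists_idempotent [FiniteDimensional F P] {x : P} (hx : ¬ IsNilpotent (Q.mul x : Module.End F P)) :
    ∃ e w, e ≠ 0 ∧ Q.mul e e = e ∧ e = Q.mul x w := by
  set f : Module.End F P := Q.mul x with hf
  have hpow : ∀ k, f ^ (k + 1) = Q.mul ((f ^ k) x) := by
    intro k
    induction k with
    | zero => simp [hf]
    | succ k ih =>
      ext z
      conv_lhs => rw [pow_succ', Module.End.mul_apply, ih]
      rw [pow_succ', Module.End.mul_apply, hf, Q.mul_assoc]
  obtain ⟨n, hn⟩ := exists_isCompl_ker_range_pow f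
  have hu := hpow n
  set u := (f ^ n) x
  have hdec : ∀ y, ∃ k s, Q.mul u k = 0 ∧ y = k + Q.mul u s := by
    intro y
    have hy : y ∈ LinearMap.ker (f ^ (n + 1)) ⊔ LinearMap.range (f ^ (n + 1)) := by
      simp [hn.sup_eq_top]
    obtain ⟨k, hk, _, ⟨s, rfl⟩, rfl⟩ := Submodule.mem_sup.1 hy
    exact ⟨k, s, by rwa [← hu], by rw [hu]⟩
  obtain ⟨k, r, hk, hr⟩ := hdec u
  obtain ⟨k', s, hk', hs⟩ := hdec r
  obtain ⟨k'', t, hk'', ht⟩ := hdec s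
  set e := Q.mul u s with he
  have hue : Q.mul u (Q.mul u e) = Q.mul u u := by
    rw [hs, map_add, hk', zero_add] at hr
    have h := congrArg (Q.mul u) hr
    rw [map_add, hk, zero_add] at h
    exact h.symm
  have het : e = Q.mul u (Q.mul u t) := by rw [he, ht, map_add, hk'', zero_add]
  have hee : Q.mul e e = e := by
    calc Q.mul e e = Q.mul (Q.mul u (Q.mul u t)) e := by rw [← het]
      _ = Q.mul (Q.mul u (Q.mul u e)) t := by
        simp only [Q.mul_assoc, Q.mul_comm t e]
      _ = e := by rw [hue, Q.mul_assoc, ← het]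
  refine ⟨e, (f ^ n) s, ?_, hee, ?_⟩
  · intro he0
    rw [he0, map_zero, map_zero] at hue
    refine hx ⟨n + 1 + (n + 1), ?_⟩
    ext z
    rw [pow_add, hu, Module.End.mul_apply, ← Q.mul_assoc, ← hue]
    simp
  · rw [he, ← hu, pow_succ', Module.End.mul_apply]

theorem bracket_eq_zero_of_idempotent {e : P} (he : Q.mul e e = e) (z : P) :
    Q.bracket e z = 0 := by
  have h1 := Q.leibniz e e z
  rw [he, Q.mul_comm (Q.bracket e z) e] at h1
  have h2 := congrArg (Q.mul e) h1
  rw [map_add, ← Q.mul_assoc, he, left_eq_add] at h2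
  rw [h1, h2, add_zero]

theorem isIdeal_ker_mul_idempotent {e : P} (he : Q.mul e e = e) :
    Q.toDialgebra.IsIdeal (LinearMap.ker (Q.mul e)) := by
  refine Q.isIdeal_of_forall fun a ha b => ?_
  rw [LinearMap.mem_ker] at ha
  refine ⟨by simp [← Q.mul_assoc, ha], ?_⟩
  have h := Q.leibniz e a b
  rw [ha, Q.bracket_eq_zero_of_idempotent he b] at h
  simpa using h.symm

theorem exists_eq_smul_idempotent_add [FiniteDimensional F P]
    (hmax : ∀ M, Q.toDialgebra.IsMaximalSubalgebraIn ⊤ M → Q.toDialgebra.IsIdeal M)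
    {e : P} (he : Q.mul e e = e) (p : P) : ∃ (c : F) (y : P), Q.mul e y = 0 ∧ p = c • e + y := by
  have hI := Q.isIdeal_ker_mul_idempotent he
  have hmem : ∀ a ∈ Submodule.span F {e} ⊔ LinearMap.ker (Q.mul e), ∃ (c : F) (y : P),
      Q.mul e y = 0 ∧ a = c • e + y := by
    intro a ha
    obtain ⟨_, hu, y, hy, rfl⟩ := Submodule.mem_sup.1 ha
    obtain ⟨c, rfl⟩ := Submodule.mem_span_singleton.1 hu
    exact ⟨c, y, hy, rfl⟩
  have hsub : Q.toDialgebra.IsSubalgebra (Submodule.span F {e} ⊔ LinearMap.ker (Q.mul e)) := by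
    refine Q.psq_le.2 fun a ha b hb => ?_
    obtain ⟨c, y, hy, rfl⟩ := hmem a ha
    obtain ⟨d, z, hz, rfl⟩ := hmem b hb
    constructor
    · simp only [map_add, map_smul, LinearMap.add_apply, LinearMap.smul_apply, he, hz,
        Q.mul_comm y e, hy, smul_zero, add_zero, zero_add]
      exact add_mem (Submodule.mem_sup_left (Submodule.smul_mem _ _ (Submodule.smul_mem _ _
        (Submodule.mem_span_singleton_self e)))) (Submodule.mem_sup_right (hI.mul_mem hy z))
    · simp only [map_add, map_smul, LinearMap.add_apply, LinearMap.smul_apply,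
        Q.bracket_eq_zero_of_idempotent he, Q.bracket_skew y e, smul_zero, add_zero, zero_add,
        neg_zero]
      exact Submodule.mem_sup_right (hI.bracket_mem hy z)
  by_cases htop : Submodule.span F {e} ⊔ LinearMap.ker (Q.mul e) = ⊤
  · exact hmem p (by simp [htop])
  obtain ⟨M, hM, hle⟩ := hsub.exists_le_maximal htop
  have heM : e ∈ M := hle (Submodule.mem_sup_left (Submodule.mem_span_singleton_self e))
  refine absurd (Submodule.eq_top_iff'.2 fun z => ?_) hM.2.1.ne
  have h2 : z - Q.mul e z ∈ M :=
    hle (Submodule.mem_sup_right (by simp [← Q.mul_assoc, he]))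
  simpa using add_mem ((hmax M hM).mul_mem heM z) h2

theorem isNilpotentSub_of_isNilpotent_mul [FiniteDimensional F P]
    (hmax : ∀ M, Q.toDialgebra.IsMaximalSubalgebraIn ⊤ M → Q.toDialgebra.IsIdeal M)
    (hB : Q.toDialgebra.IsSubalgebra B)
    (h : ∀ x ∈ B, IsNilpotent (Q.mul x : Module.End F P)) : Q.toDialgebra.IsNilpotentSub B := by
  obtain ⟨c, hc⟩ :=
    Q.lieNilpotent_top_of_forall (Q.isNilpotent_bracket_of_maximal_isIdeal hmax)
  exact Q.isNilpotentSub_of_assoc_lie hB (Q.assocNilpotent_of_forall h)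
    ⟨c, le_bot_iff.1 (hc ▸ lpow_mono le_top c)⟩

/-- The annihilator of a nonzero idempotent contains no further nonzero idempotent. -/
theorem isNilpotent_mul_of_mul_idempotent_eq_zero [FiniteDimensional F P]
    (hmax : ∀ M, Q.toDialgebra.IsMaximalSubalgebraIn ⊤ M → Q.toDialgebra.IsIdeal M)
    {e x : P} (he0 : e ≠ 0) (he : Q.mul e e = e) (hx : Q.mul e x = 0) :
    IsNilpotent (Q.mul x : Module.End F P) := by
  by_contra hnil
  obtain ⟨g, w, hg0, hg, rfl⟩ := Q.exists_idempotent hnil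
  set g := Q.mul x w
  have heg : Q.mul e g = 0 := by rw [← Q.mul_assoc, hx]; simp
  have hge : Q.mul g e = 0 := by rw [Q.mul_comm, heg]
  have hsum : Q.mul (e + g) (e + g) = e + g := by simp [he, hg, heg, hge]
  obtain ⟨c, y, hy, hey⟩ := Q.exists_eq_smul_idempotent_add hmax hsum e
  have h1 : e = c • (e + g) := by
    have h := congrArg (Q.mul (e + g)) hey
    rw [map_add (Q.mul (e + g)) _ y, hy, add_zero, map_smul, hsum] at h
    simpa [he, hge] using h
  have h2 := congrArg (Q.mul g) h1
  have hc : c = 0 := by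
    rw [map_smul, map_add, hg, hge, zero_add, eq_comm, smul_eq_zero] at h2
    exact h2.resolve_right hg0
  exact he0 (by simpa [hc] using h1)

end PoissonAlgebra

/-- A Poisson algebra is nilpotent iff `φ(P) = P²`; nilpotency implies every maximal
subalgebra is an ideal; and if every maximal subalgebra is an ideal then `P` is
nilpotent or `P = Fe ⊕ N` with `e` idempotent and `N` the nilradical. -/
theorem nilpotent_iff_phi_eq_square {F P : Type*} [Field F] [AddCommGroup P] [Module F P]
    [FiniteDimensional F P] (Q : PoissonAlgebra F P) (N : Submodule F P)
    (hN : Q.toDialgebra.IsNilradical N) :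
    (Q.toDialgebra.IsNilpotentSub ⊤ ↔ Q.toDialgebra.phi = Q.toDialgebra.psq ⊤ ⊤) ∧
    (Q.toDialgebra.IsNilpotentSub ⊤ →
      ∀ M, Q.toDialgebra.IsMaximalSubalgebraIn ⊤ M → Q.toDialgebra.IsIdeal M) ∧
    ((∀ M, Q.toDialgebra.IsMaximalSubalgebraIn ⊤ M → Q.toDialgebra.IsIdeal M) →
      Q.toDialgebra.IsNilpotentSub ⊤ ∨
      ∃ e : P, e ≠ 0 ∧ Q.mul e e = e ∧
        (∀ x ∈ N, Q.mul e x = 0 ∧ Q.bracket e x = 0) ∧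
        Submodule.span F {e} ⊓ N = ⊥ ∧ Submodule.span F {e} ⊔ N = ⊤) := by
  have hsup : ∀ M, Q.toDialgebra.IsNilpotentSub ⊤ → Q.toDialgebra.IsMaximalSubalgebraIn ⊤ M →
      Q.toDialgebra.psq ⊤ ⊤ ≤ M := fun M h hM => Q.psq_top_le_of_isMaximalSubalgebraIn h hM
  have htop : Q.toDialgebra.IsSubalgebra ⊤ := le_top
  refine ⟨⟨fun h => Q.phi_eq_psq_top_iff.2 fun M => hsup M h, fun h => ?_⟩,
    fun h M hM => Dialgebra.isIdeal_of_psq_top_le (hsup M h hM), fun hmax => ?_⟩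
  · have hle := Q.phi_eq_psq_top_iff.1 h
    have hmax : ∀ M, Q.toDialgebra.IsMaximalSubalgebraIn ⊤ M → Q.toDialgebra.IsIdeal M :=
      fun M hM => Dialgebra.isIdeal_of_psq_top_le (hle M hM)
    refine Q.isNilpotentSub_of_isNilpotent_mul hmax htop fun x _ => ?_
    by_contra hx
    obtain ⟨e, -, he0, he, -⟩ := Q.exists_idempotent hx
    have hne : LinearMap.ker (Q.mul e) ≠ ⊤ := fun hker => he0 <| by
      have hmem : e ∈ LinearMap.ker (Q.mul e) := hker ▸ Submodule.mem_top
      rwa [LinearMap.mem_ker, he] at hmem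
    have hI := Q.isIdeal_ker_mul_idempotent he
    obtain ⟨M, hM, hker⟩ := Dialgebra.IsSubalgebra.exists_le_maximal
      (Q.psq_le.2 fun a ha b _ => ⟨hI.mul_mem ha b, hI.bracket_mem ha b⟩) hne
    have heM : e ∈ M :=
      hle M hM (he ▸ Dialgebra.mul_mem_psq Submodule.mem_top Submodule.mem_top)
    refine hM.2.1.ne (Submodule.eq_top_iff'.2 fun z => ?_)
    obtain ⟨c, y, hy, rfl⟩ := Q.exists_eq_smul_idempotent_add hmax he z
    exact add_mem (M.smul_mem c heM) (hker hy)
  · by_cases hnil : ∀ x, IsNilpotent (Q.mul x : Module.End F P)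
    · exact Or.inl (Q.isNilpotentSub_of_isNilpotent_mul hmax htop fun x _ => hnil x)
    obtain ⟨x, hx⟩ := not_forall.1 hnil
    obtain ⟨e, -, he0, he, -⟩ := Q.exists_idempotent hx
    have hI := Q.isIdeal_ker_mul_idempotent he
    have hker : LinearMap.ker (Q.mul e) ≤ N := hN.2.2 _ hI <|
      Q.isNilpotentSub_of_isNilpotent_mul hmax
        (Q.psq_le.2 fun a ha b _ => ⟨hI.mul_mem ha b, hI.bracket_mem ha b⟩)
        fun y hy => Q.isNilpotent_mul_of_mul_idempotent_eq_zero hmax he0 he hy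
    have heN : e ∉ N := by
      intro heN
      obtain ⟨n, hn⟩ := hN.2.1
      have hall : ∀ k, e ∈ Q.toDialgebra.lcs N k := by
        intro k
        induction k with
        | zero => exact heN
        | succ k ih => exact he ▸ Dialgebra.mul_mem_psq ih heN
      exact he0 (by simpa [hn] using hall n)
    have hspan : ∀ c : F, c • e ∈ N → c = 0 := by
      intro c hc
      by_contra hc0
      exact heN ((N.smul_mem_iff hc0).1 hc)
    refine Or.inr ⟨e, he0, he, fun y hy => ⟨?_, Q.bracket_eq_zero_of_idempotent he y⟩, ?_, ?_⟩
    · obtain ⟨c, z, hz, rfl⟩ := Q.exists_eq_smul_idempotent_add hmax he y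
      have hc := hspan c (by simpa using sub_mem hy (hker hz))
      simp [hc, hz]
    · refine (Submodule.eq_bot_iff _).2 fun y hy => ?_
      obtain ⟨c, rfl⟩ := Submodule.mem_span_singleton.1 hy.1
      simp [hspan c hy.2]
    · refine Submodule.eq_top_iff'.2 fun z => ?_
      obtain ⟨c, y, hy, rfl⟩ := Q.exists_eq_smul_idempotent_add hmax he z
      exact add_mem
        (Submodule.mem_sup_left (Submodule.smul_mem _ c (Submodule.mem_span_singleton_self e)))
        (Submodule.mem_sup_right (hker hy))
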